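/- arXiv:1809.00738 — 8 statements merged into one kernel-verified Lean document; each statement's English description precedes it below -/
import Mathlib

section
/- For a symmetric monoidal category (C, ⊗, I), the pairs of objects of C together with the optic hom-sets, the given composition, and the given identities form a category Optic_C: the composition ⟨l|r⟩ ∘ ⟨l'|r'⟩ := ⟨(M'⊗l)∘l' | r'∘(M'⊗r)⟩ is well defined on equivalence classes, associative, and has the optics ⟨λ_S⁻¹ | λ_{S'}⟩ as identities. -/
/-!
STATEMENT 0: For a symmetric monoidal category `(C, ⊗, I)`, the pairs of objects of `C`
together with the optic hom-sets, the given composition, and the given identities form a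
category `Optic_C`: the composition `⟨l|r⟩ ∘ ⟨l'|r'⟩ := ⟨(M'⊗l)∘l' | r'∘(M'⊗r)⟩` is well
defined on equivalence classes, associative, and has the optics `⟨λ_S⁻¹ | λ_{S'}⟩` as
identities.
-/

open CategoryTheory MonoidalCategory

universe v u

variable (C : Type u) [Category.{v} C] [MonoidalCategory C]

/-- A representative of an optic `(S, S') ⇸ (A, A')`: a residual `m` together with
`l : S ⟶ m ⊗ A` and `r : m ⊗ A' ⟶ S'`. -/
structure OpticRep (S S' A A' : C) : Type max u v where
  m : C
  l : S ⟶ m ⊗ A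
  r : m ⊗ A' ⟶ S'

variable {C}

/-- The generating relation of the coend `∫^M C(S, M⊗A) × C(M⊗A', S')`:
`⟨(f⊗A)∘l | r⟩ ∼ ⟨l | r∘(f⊗A')⟩` for `f : m ⟶ n`. -/
inductive OpticRel {S S' A A' : C} : OpticRep C S S' A A' → OpticRep C S S' A A' → Prop
  | slide {m n : C} (f : m ⟶ n) (l : S ⟶ m ⊗ A) (r : n ⊗ A' ⟶ S') :
      OpticRel ⟨n, l ≫ (f ▷ A), r⟩ ⟨m, l, (f ▷ A') ≫ r⟩

/-- The set of optics `(S, S') ⇸ (A, A')`: the coend `∫^M C(S, M⊗A) × C(M⊗A', S')`,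
i.e. representatives modulo the equivalence relation generated by `OpticRel`. -/
def Optic (S S' A A' : C) : Type max u v :=
  Quot (@OpticRel C _ _ S S' A A')

/-- The class `⟨l | r⟩` of a representative. -/
def Optic.mk {S S' A A' : C} (p : OpticRep C S S' A A') : Optic S S' A A' :=
  Quot.mk _ p

/-- Composition of representatives:
`⟨l|r⟩ ∘ ⟨l'|r'⟩ := ⟨(M'⊗l)∘l' | r'∘(M'⊗r)⟩`, with residual `M' ⊗ M`
(associators inserted). -/
def compRep {R R' S S' A A' : C} (q : OpticRep C S S' A A') (p : OpticRep C R R' S S') :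
    OpticRep C R R' A A' where
  m := p.m ⊗ q.m
  l := p.l ≫ (p.m ◁ q.l) ≫ (α_ p.m q.m A).inv
  r := (α_ p.m q.m A').hom ≫ (p.m ◁ q.r) ≫ p.r

/-- The representative `⟨λ_S⁻¹ | λ_{S'}⟩` of the identity optic. -/
def idRep (S S' : C) : OpticRep C S S' S S' where
  m := 𝟙_ C
  l := (λ_ S).inv
  r := (λ_ S').hom

theorem Optic.mk_eq {S S' A A' : C} (p q : OpticRep C S S' A A') (f : q.m ⟶ p.m)
    (hl : p.l = q.l ≫ f ▷ A) (hr : q.r = f ▷ A' ≫ p.r) : Optic.mk p = Optic.mk q := by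
  obtain ⟨n, l, r⟩ := p
  obtain ⟨m, l', r'⟩ := q
  dsimp only at f hl hr
  subst hl hr
  exact Quot.sound (OpticRel.slide f l' r)

/-- The pairs of objects of `C`, the optic hom-sets, the given composition
and the given identities form a category: the composition descends to the quotients
(well-definedness), is associative there, and the optics `⟨λ_S⁻¹ | λ_{S'}⟩` are identities. -/
theorem optic_is_category (C : Type u) [Category.{v} C] [MonoidalCategory C]
    [SymmetricCategory C] :
    ∃ comp : ∀ (R R' S S' A A' : C),
        Optic S S' A A' → Optic R R' S S' → Optic R R' A A',
      -- `comp` is computed on representatives by `compRep`; in particular the formula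
      -- `⟨l|r⟩ ∘ ⟨l'|r'⟩ := ⟨(M'⊗l)∘l' | r'∘(M'⊗r)⟩` is well defined on equivalence classes
      (∀ (R R' S S' A A' : C) (q : OpticRep C S S' A A') (p : OpticRep C R R' S S'),
          comp R R' S S' A A' (Optic.mk q) (Optic.mk p) = Optic.mk (compRep q p)) ∧
      -- associativity
      (∀ (T T' R R' S S' A A' : C) (u : Optic S S' A A') (q : Optic R R' S S')
          (p : Optic T T' R R'),
          comp T T' S S' A A' u (comp T T' R R' S S' q p) =
            comp T T' R R' A A' (comp R R' S S' A A' u q) p) ∧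
      -- the optics `⟨λ_S⁻¹ | λ_{S'}⟩` are left and right identities
      (∀ (S S' A A' : C) (p : Optic S S' A A'),
          comp S S' A A' A A' (Optic.mk (idRep A A')) p = p ∧
          comp S S' S S' A A' p (Optic.mk (idRep S S')) = p) := by
  refine ⟨fun R R' S S' A A' u w => Quot.liftOn₂ u w (fun q p => Optic.mk (compRep q p))
    ?_ ?_, ?_, ?_, ?_⟩
  · rintro q _ _ ⟨f, l, r⟩
    refine Optic.mk_eq _ _ (f ▷ q.m) ?_ ?_
    · simp [compRep, ← whisker_exchange_assoc]
    · simp [compRep, whisker_exchange_assoc]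
  · rintro _ _ p ⟨f, l, r⟩
    refine Optic.mk_eq _ _ (p.m ◁ f) ?_ ?_
    · simp [compRep]
    · simp [compRep]
  · intros
    rfl
  · rintro T T' R R' S S' A A' ⟨u⟩ ⟨q⟩ ⟨p⟩
    refine Optic.mk_eq (compRep u (compRep q p)) (compRep (compRep u q) p)
      (α_ p.m q.m u.m).inv ?_ ?_
    · simp [compRep]
    · simp [compRep]
  · rintro S S' A A' ⟨p⟩
    constructor
    · refine (Optic.mk_eq p (compRep (idRep A A') p) (ρ_ p.m).hom ?_ ?_).symm
      · simp [compRep, idRep]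
      · simp [compRep, idRep]
    · refine (Optic.mk_eq p (compRep p (idRep S S')) (λ_ p.m).hom ?_ ?_).symm
      · simp [compRep, idRep]
      · simp [compRep, idRep]
end

section
/- Let C be a category with finite products, regarded as a symmetric monoidal category under the cartesian product. Then there is an isomorphism Optic_×((S,S'),(A,A')) ≅ C(S,A) × C(S×A', S'), natural in both pairs, sending an optic ⟨l|r⟩ to the pair (Get, Put) with Get = π₂∘l and Put = r∘((π₁∘l) × id_{A'}), with inverse sending (Get, Put) to ⟨[id_S, Get] | Put⟩; under this isomorphism composition of optics agrees with the usual composition of concrete lenses. -/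
/-!
STATEMENT 1: Let `C` be a category with finite products, regarded as a symmetric monoidal
category under the cartesian product. Then there is an isomorphism
`Optic_×((S,S'),(A,A')) ≅ C(S,A) × C(S×A', S')`, natural in both pairs, sending an optic
`⟨l|r⟩` to the pair `(Get, Put)` with `Get = π₂∘l` and `Put = r∘((π₁∘l) × id_{A'})`, with
inverse sending `(Get, Put)` to `⟨[id_S, Get] | Put⟩`; under this isomorphism composition
of optics agrees with the usual composition of concrete lenses.
-/

open CategoryTheory Limits

universe v u

variable (C : Type u) [Category.{v} C] [HasFiniteProducts C]

/-- A representative of an optic for the cartesian monoidal structure. -/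
structure LensOpticRep (S S' A A' : C) : Type max u v where
  m : C
  l : S ⟶ m ⨯ A
  r : m ⨯ A' ⟶ S'

variable {C}

/-- The coend relation `⟨(f×A)∘l | r⟩ ∼ ⟨l | r∘(f×A')⟩`. -/
inductive LensOpticRel {S S' A A' : C} :
    LensOpticRep C S S' A A' → LensOpticRep C S S' A A' → Prop
  | slide {m n : C} (f : m ⟶ n) (l : S ⟶ m ⨯ A) (r : n ⨯ A' ⟶ S') :
      LensOpticRel ⟨n, l ≫ prod.map f (𝟙 A), r⟩ ⟨m, l, prod.map f (𝟙 A') ≫ r⟩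

/-- The set of optics `(S,S') ⇸ (A,A')` for the cartesian monoidal structure. -/
def LensOptic (S S' A A' : C) : Type max u v :=
  Quot (@LensOpticRel C _ _ S S' A A')

def LensOptic.mk {S S' A A' : C} (p : LensOpticRep C S S' A A') : LensOptic S S' A A' :=
  Quot.mk _ p

/-- Composition of representatives `⟨l|r⟩ ∘ ⟨l'|r'⟩ := ⟨(M'×l)∘l' | r'∘(M'×r)⟩`. -/
noncomputable def LensOptic.compRep {R R' S S' A A' : C} (q : LensOpticRep C S S' A A')
    (p : LensOpticRep C R R' S S') : LensOpticRep C R R' A A' where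
  m := p.m ⨯ q.m
  l := p.l ≫ prod.map (𝟙 p.m) q.l ≫ (prod.associator p.m q.m A).inv
  r := (prod.associator p.m q.m A').hom ≫ prod.map (𝟙 p.m) q.r ≫ p.r

/-- The concrete `Get` of an optic representative: `π₂ ∘ l`. -/
noncomputable def repGet {S S' A A' : C} (p : LensOpticRep C S S' A A') : S ⟶ A :=
  p.l ≫ prod.snd

/-- The concrete `Put` of an optic representative: `r ∘ ((π₁ ∘ l) × id_{A'})`. -/
noncomputable def repPut {S S' A A' : C} (p : LensOpticRep C S S' A A') : S ⨯ A' ⟶ S' :=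
  prod.map (p.l ≫ prod.fst) (𝟙 A') ≫ p.r

/-- The optic `⟨[id_S, Get] | Put⟩` associated to a concrete lens `(Get, Put)`. -/
noncomputable def lensRep {S S' A A' : C} (Get : S ⟶ A) (Put : S ⨯ A' ⟶ S') : LensOpticRep C S S' A A' :=
  ⟨S, prod.lift (𝟙 S) Get, Put⟩

/-- Composition of concrete lenses:
`Get = Get₂ ∘ Get₁` and `Put = Put₁ ∘ (id_T × Put₂) ∘ ([id_T, Get₁] × id_A)`. -/
noncomputable def concreteComp {T T' S S' A A' : C} (Get₂ : S ⟶ A) (Put₂ : S ⨯ A' ⟶ S')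
    (Get₁ : T ⟶ S) (Put₁ : T ⨯ S' ⟶ T') : (T ⟶ A) × (T ⨯ A' ⟶ T') :=
  (Get₁ ≫ Get₂,
    prod.map (prod.lift (𝟙 T) Get₁) (𝟙 A') ≫ (prod.associator T S A').hom ≫
      prod.map (𝟙 T) Put₂ ≫ Put₁)

/-- `Optic_×((S,S'),(A,A')) ≅ C(S,A) × C(S×A',S')`, by
`⟨l|r⟩ ↦ (π₂∘l, r∘((π₁∘l)×A'))` with inverse `(Get,Put) ↦ ⟨[id_S,Get] | Put⟩`;
the isomorphism is natural in both pairs, and composition of optics corresponds to the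
usual composition of concrete lenses. -/
theorem lens_optic_concrete (C : Type u) [Category.{v} C] [HasFiniteProducts C] :
    ∃ e : ∀ S S' A A' : C, LensOptic S S' A A' ≃ (S ⟶ A) × (S ⨯ A' ⟶ S'),
      -- the forward map is `⟨l|r⟩ ↦ (Get, Put)` (in particular this is well defined on
      -- equivalence classes)
      (∀ (S S' A A' : C) (p : LensOpticRep C S S' A A'),
          e S S' A A' (LensOptic.mk p) = (repGet p, repPut p)) ∧
      -- the inverse map is `(Get, Put) ↦ ⟨[id_S, Get] | Put⟩`
      (∀ (S S' A A' : C) (Get : S ⟶ A) (Put : S ⨯ A' ⟶ S'),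
          (e S S' A A').symm (Get, Put) = LensOptic.mk (lensRep Get Put)) ∧
      -- naturality in the pair `(S, S')` (contravariant in `S`, covariant in `S'`):
      (∀ (S S' A A' T T' : C) (f : T ⟶ S) (g : S' ⟶ T') (p : LensOpticRep C S S' A A'),
          e T T' A A' (LensOptic.mk ⟨p.m, f ≫ p.l, p.r ≫ g⟩) =
            (f ≫ repGet p, prod.map f (𝟙 A') ≫ repPut p ≫ g)) ∧
      -- naturality in the pair `(A, A')` (covariant in `A`, contravariant in `A'`):
      (∀ (S S' A A' B B' : C) (h : A ⟶ B) (k : B' ⟶ A') (p : LensOpticRep C S S' A A'),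
          e S S' B B' (LensOptic.mk ⟨p.m, p.l ≫ prod.map (𝟙 p.m) h,
              prod.map (𝟙 p.m) k ≫ p.r⟩) =
            (repGet p ≫ h, prod.map (𝟙 S) k ≫ repPut p)) ∧
      -- composition of optics agrees with composition of concrete lenses
      (∀ (T T' S S' A A' : C) (q : LensOpticRep C S S' A A')
          (p : LensOpticRep C T T' S S'),
          e T T' A A' (LensOptic.mk (LensOptic.compRep q p)) =
            concreteComp (repGet q) (repPut q) (repGet p) (repPut p)) := by
  let e : ∀ S S' A A' : C, LensOptic S S' A A' ≃ (S ⟶ A) × (S ⨯ A' ⟶ S') :=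
    fun S S' A A' =>
    { toFun := Quot.lift (fun p => (repGet p, repPut p)) (by
        rintro _ _ ⟨f, l, r⟩
        simp [repGet, repPut])
      invFun := fun x => LensOptic.mk (lensRep x.1 x.2)
      left_inv := by
        rintro ⟨p⟩
        obtain ⟨m, l, r⟩ := p
        have h := Quot.sound (LensOpticRel.slide (l ≫ prod.fst)
          (prod.lift (𝟙 S) (l ≫ prod.snd)) r)
        have hl : prod.lift (𝟙 S) (l ≫ prod.snd) ≫ prod.map (l ≫ prod.fst) (𝟙 A) = l := by
          ext <;> simp [prod.lift_fst, prod.lift_snd, prod.lift_fst_assoc, prod.lift_snd_assoc]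
        rw [hl] at h
        exact h.symm
      right_inv := by
        rintro ⟨g, p⟩
        change (repGet (lensRep g p), repPut (lensRep g p)) = (g, p)
        simp [repGet, repPut, lensRep, prod.lift_fst, prod.lift_snd, prod.lift_fst_assoc, prod.lift_snd_assoc] }
  have he : ∀ (S S' A A' : C) (p : LensOpticRep C S S' A A'),
      e S S' A A' (LensOptic.mk p) = (repGet p, repPut p) := fun _ _ _ _ _ => rfl
  refine ⟨e, he, fun _ _ _ _ _ _ => rfl, ?_, ?_, ?_⟩
  · intro S S' A A' T T' f g p
    rw [he]
    simp [repGet, repPut]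
  · intro S S' A A' B B' h k p
    rw [he]
    simp [repGet, repPut]
  · intro T T' S S' A A' q p
    rw [he]
    refine Prod.ext ?_ ?_
    · simp [repGet, concreteComp, LensOptic.compRep, prod.lift_fst, prod.lift_snd, prod.lift_fst_assoc, prod.lift_snd_assoc]
    · obtain ⟨m, l, r⟩ := p
      obtain ⟨n, l', r'⟩ := q
      change prod.map ((l ≫ prod.map (𝟙 m) l' ≫ (prod.associator m n A).inv) ≫
          (prod.fst : (m ⨯ n) ⨯ A ⟶ m ⨯ n)) (𝟙 A') ≫
          (prod.associator m n A').hom ≫ prod.map (𝟙 m) r' ≫ r =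
        prod.map (prod.lift (𝟙 T) (l ≫ prod.snd)) (𝟙 A') ≫ (prod.associator T S A').hom ≫
          prod.map (𝟙 T) (prod.map (l' ≫ prod.fst) (𝟙 A') ≫ r') ≫
          prod.map (l ≫ prod.fst) (𝟙 S') ≫ r
      simp only [← Category.assoc]
      congr 1
      ext <;> simp [prod.lift_fst, prod.lift_snd, prod.lift_fst_assoc, prod.lift_snd_assoc]
end

section
/- There is a functor ι : C × C^op → Optic_C which is the identity on objects, ι(S,S') = (S,S'), and sends a morphism (f,g) : (S,S') → (A,A') of C × C^op to the optic ι(f,g) := ⟨λ_A⁻¹∘f | g∘λ_{A'}⟩ with residual I; that is, ι preserves identities and composition. -/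
/-!
STATEMENT 2: There is a functor `ι : C × C^op → Optic_C` which is the identity on objects,
`ι(S,S') = (S,S')`, and sends a morphism `(f,g) : (S,S') → (A,A')` of `C × C^op` to the
optic `ι(f,g) := ⟨λ_A⁻¹∘f | g∘λ_{A'}⟩` with residual `I`; that is, `ι` preserves identities
and composition.
-/

open CategoryTheory MonoidalCategory

universe v u

variable (C : Type u) [Category.{v} C] [MonoidalCategory C]

variable {C}

/-- `ι` on a morphism `(f, g) : (S,S') ⟶ (A,A')` of `C × C^op`
(so `f : S ⟶ A` and `g : A' ⟶ S'` in `C`): the representative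
`⟨λ_A⁻¹ ∘ f | g ∘ λ_{A'}⟩` with residual `I`. -/
def iotaRep {S S' A A' : C} (f : S ⟶ A) (g : A' ⟶ S') : OpticRep C S S' A A' where
  m := 𝟙_ C
  l := f ≫ (λ_ A).inv
  r := (λ_ A').hom ≫ g

/-- `ι : C × C^op → Optic_C`, identity on objects and
`(f, g) ↦ ⟨λ_A⁻¹∘f | g∘λ_{A'}⟩` on morphisms, is a functor: it sends identities of
`C × C^op` to the identity optics, and composition in `C × C^op` to composition of optics
(the latter being computed on representatives by `compRep`). -/
theorem iota_is_functor (C : Type u) [Category.{v} C] [MonoidalCategory C]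
    [SymmetricCategory C] :
    (∀ S S' : C, Optic.mk (iotaRep (𝟙 S) (𝟙 S')) = Optic.mk (idRep S S')) ∧
    (∀ (S S' A A' B B' : C) (f : S ⟶ A) (g : A' ⟶ S') (f' : A ⟶ B) (g' : B' ⟶ A'),
        Optic.mk (compRep (iotaRep f' g') (iotaRep f g)) =
          Optic.mk (iotaRep (f ≫ f') (g' ≫ g))) := by
  refine ⟨fun S S' => by simp [iotaRep, idRep], ?_⟩
  intro S S' A A' B B' f g f' g'
  have h := Quot.sound (OpticRel.slide (λ_ (𝟙_ C)).inv ((f ≫ f') ≫ (λ_ B).inv)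
    (compRep (iotaRep f' g') (iotaRep f g)).r)
  have hl : ((f ≫ f') ≫ (λ_ B).inv) ≫ (λ_ (𝟙_ C)).inv ▷ B =
      (compRep (iotaRep f' g') (iotaRep f g)).l := by
    simp only [compRep, iotaRep]
    simp [MonoidalCategory.whiskerLeft_comp, ← leftUnitor_inv_naturality_assoc]
  have hr : (λ_ (𝟙_ C)).inv ▷ B' ≫ (compRep (iotaRep f' g') (iotaRep f g)).r =
      (λ_ B').hom ≫ (g' ≫ g) := by
    simp only [compRep, iotaRep]
    simp
  rw [hl, hr] at h
  exact h
end

section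
/- For any objects S, S' of C, the set of costates Optic_C((S,S'),(I,I)) is isomorphic to C(S,S'): the isomorphism sends an optic ⟨l|r⟩ to the composite r∘l : S → S', and a morphism f : S → S' to the optic ⟨ρ_S⁻¹ | f∘ρ_S⟩, where ρ is the right unitor. -/
/-!
STATEMENT 3: For any objects `S, S'` of `C`, the set of costates
`Optic_C((S,S'),(I,I))` is isomorphic to `C(S,S')`: the isomorphism sends an optic
`⟨l|r⟩` to the composite `r∘l : S ⟶ S'`, and a morphism `f : S ⟶ S'` to the optic
`⟨ρ_S⁻¹ | f∘ρ_S⟩`, where `ρ` is the right unitor.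
-/

open CategoryTheory MonoidalCategory

universe v u

variable (C : Type u) [Category.{v} C] [MonoidalCategory C]

variable {C}

/-- The set of costates `(S,S') ⇸ (I,I)` is isomorphic to `C(S,S')`:
an optic `⟨l|r⟩` is sent to `r ∘ l`, and a morphism `f : S ⟶ S'` is sent to the optic
`⟨ρ_S⁻¹ | f ∘ ρ_S⟩`. -/
theorem costates_iso (C : Type u) [Category.{v} C] [MonoidalCategory C]
    [SymmetricCategory C] (S S' : C) :
    ∃ e : Optic S S' (𝟙_ C) (𝟙_ C) ≃ (S ⟶ S'),
      (∀ p : OpticRep C S S' (𝟙_ C) (𝟙_ C), e (Optic.mk p) = p.l ≫ p.r) ∧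
      (∀ f : S ⟶ S', e.symm f = Optic.mk ⟨S, (ρ_ S).inv, (ρ_ S).hom ≫ f⟩) := by
  refine ⟨{ toFun := Quot.lift (fun p => p.l ≫ p.r) ?_
            invFun := fun f => Optic.mk ⟨S, (ρ_ S).inv, (ρ_ S).hom ≫ f⟩
            left_inv := ?_
            right_inv := ?_ }, ?_, ?_⟩
  · rintro _ _ ⟨f, l, r⟩
    simp
  · rintro ⟨m, l, r⟩
    have key : (l ≫ (ρ_ m).hom) ▷ (𝟙_ C) = (ρ_ S).hom ≫ l := by
      simp [MonoidalCategory.whiskerRight_id]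
    have h := Quot.sound (OpticRel.slide (l ≫ (ρ_ m).hom) (ρ_ S).inv r)
    rw [key, Iso.inv_hom_id_assoc, Category.assoc] at h
    exact h.symm
  · intro f
    change (ρ_ S).inv ≫ (ρ_ S).hom ≫ f = f
    simp
  · intro p
    rfl
  · intro f
    rfl
end

section
/- Suppose the monoidal unit I of C is a terminal object. Then for any objects A, A' of C, the set of states Optic_C((I,I),(A,A')) is isomorphic to C(I,A); explicitly, a morphism f : I → A corresponds to the optic ⟨λ_A⁻¹∘f | !_{I⊗A'}⟩ where !_{I⊗A'} : I⊗A' → I is the unique map to the terminal object. -/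
/-!
STATEMENT 4: Suppose the monoidal unit `I` of `C` is a terminal object. Then for any
objects `A, A'` of `C`, the set of states `Optic_C((I,I),(A,A'))` is isomorphic to
`C(I,A)`; explicitly, a morphism `f : I ⟶ A` corresponds to the optic
`⟨λ_A⁻¹∘f | !_{I⊗A'}⟩` where `!_{I⊗A'} : I⊗A' ⟶ I` is the unique map to the terminal
object.
-/

open CategoryTheory MonoidalCategory Limits

universe v u

variable (C : Type u) [Category.{v} C] [MonoidalCategory C]

variable {C}

/-- If the monoidal unit `I` is terminal, then the set of states
`(I,I) ⇸ (A,A')` is isomorphic to `C(I,A)`; a morphism `f : I ⟶ A` corresponds to the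
optic `⟨λ_A⁻¹ ∘ f | ! ⟩` with residual `I`, where `!` is the unique map `I ⊗ A' ⟶ I`. -/
theorem states_iso (C : Type u) [Category.{v} C] [MonoidalCategory C]
    [SymmetricCategory C] (hI : IsTerminal (𝟙_ C)) (A A' : C) :
    ∃ e : Optic (𝟙_ C) (𝟙_ C) A A' ≃ (𝟙_ C ⟶ A),
      ∀ f : 𝟙_ C ⟶ A,
        e.symm f = Optic.mk ⟨𝟙_ C, f ≫ (λ_ A).inv, hI.from (𝟙_ C ⊗ A')⟩ := by
  refine ⟨⟨Quot.lift (fun p => p.l ≫ (hI.from p.m ▷ A) ≫ (λ_ A).hom) ?_,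
    fun f => Optic.mk ⟨𝟙_ C, f ≫ (λ_ A).inv, hI.from (𝟙_ C ⊗ A')⟩, ?_, ?_⟩, fun f => rfl⟩
  · rintro _ _ ⟨f, l, r⟩
    have h : hI.from _ = f ≫ hI.from _ := hI.hom_ext _ _
    simp only [Category.assoc]
    rw [h, comp_whiskerRight, Category.assoc]
  · rintro ⟨m, l, r⟩
    have h : r = (hI.from m ▷ A') ≫ hI.from (𝟙_ C ⊗ A') := hI.hom_ext _ _
    subst h
    have key := Quot.sound (OpticRel.slide (hI.from m) l (hI.from (𝟙_ C ⊗ A')))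
    refine Eq.trans ?_ key
    simp [Optic.mk]
    rfl
  · intro f
    have h : hI.from (𝟙_ C) = 𝟙 _ := hI.hom_ext _ _
    simp [Optic.mk, h]
end

section
/- For a monoidal category M acting on C, the objects of the form (S,S) together with the lawful optics between them form a subcategory Lawful_M of Optic_M: identity optics are lawful, and the composite of two lawful optics is lawful. -/
/-!
STATEMENT 13: For a monoidal category `M` acting on `C`, the objects of the form `(S,S)`
together with the lawful optics between them form a subcategory `Lawful_M` of `Optic_M`:
identity optics are lawful, and the composite of two lawful optics is lawful.
-/

open CategoryTheory MonoidalCategory Functor.LaxMonoidal Functor.OplaxMonoidal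

universe v u v' u'

attribute [local instance] CategoryTheory.endofunctorMonoidalCategory

variable {M : Type u'} [Category.{v'} M] [MonoidalCategory M]
variable {C : Type u} [Category.{v} C]

section Defs

/-- A representative of an optic `(S,S') ⇸ (A,A')` for the action of `M` on `C` given by
the monoidal functor `a : M ⥤ [C,C]` (we write `m·A` for `(a.obj m).obj A`). -/
structure ActOpticRep (a : M ⥤ C ⥤ C) (S S' A A' : C) : Type max u v u' where
  m : M
  l : S ⟶ (a.obj m).obj A
  r : (a.obj m).obj A' ⟶ S'

variable (a : M ⥤ C ⥤ C)

/-- The coend relation `⟨(f·A)∘l | r⟩ ∼ ⟨l | r∘(f·A')⟩` for `f : m ⟶ n` in `M`. -/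
inductive ActOpticRel {S S' A A' : C} :
    ActOpticRep a S S' A A' → ActOpticRep a S S' A A' → Prop
  | slide {m n : M} (f : m ⟶ n) (l : S ⟶ (a.obj m).obj A) (r : (a.obj n).obj A' ⟶ S') :
      ActOpticRel ⟨n, l ≫ (a.map f).app A, r⟩ ⟨m, l, (a.map f).app A' ≫ r⟩

/-- The set of optics `(S,S') ⇸ (A,A')` for the action `a`. -/
def ActOptic (S S' A A' : C) : Type max u v u' :=
  Quot (ActOpticRel a (S := S) (S' := S') (A := A) (A' := A'))

/-- A representative of an element of
`Optic²(S,A) = ∫^{M₁,M₂} C(S, M₁·A) × C(M₁·A, M₂·A) × C(M₂·A, S)`. -/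
structure ActOptic2Rep (S A : C) : Type max u v u' where
  m₁ : M
  m₂ : M
  l : S ⟶ (a.obj m₁).obj A
  c : (a.obj m₁).obj A ⟶ (a.obj m₂).obj A
  r : (a.obj m₂).obj A ⟶ S

/-- The coend relations for `Optic²(S,A)`. -/
inductive ActOptic2Rel {S A : C} : ActOptic2Rep a S A → ActOptic2Rep a S A → Prop
  | slideL {m₁ n₁ m₂ : M} (f : m₁ ⟶ n₁) (l : S ⟶ (a.obj m₁).obj A)
      (c : (a.obj n₁).obj A ⟶ (a.obj m₂).obj A) (r : (a.obj m₂).obj A ⟶ S) :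
      ActOptic2Rel ⟨n₁, m₂, l ≫ (a.map f).app A, c, r⟩
        ⟨m₁, m₂, l, (a.map f).app A ≫ c, r⟩
  | slideR {m₁ m₂ n₂ : M} (g : m₂ ⟶ n₂) (l : S ⟶ (a.obj m₁).obj A)
      (c : (a.obj m₁).obj A ⟶ (a.obj m₂).obj A) (r : (a.obj n₂).obj A ⟶ S) :
      ActOptic2Rel ⟨m₁, n₂, l, c ≫ (a.map g).app A, r⟩
        ⟨m₁, m₂, l, c, (a.map g).app A ≫ r⟩

def ActOptic2 (S A : C) : Type max u v u' :=
  Quot (ActOptic2Rel a (S := S) (A := A))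

/-- `once(⟨l|r⟩) = ⟨l | id | r⟩`. -/
def actOnce {S A : C} (p : ActOpticRep a S S A A) : ActOptic2 a S A :=
  Quot.mk _ ⟨p.m, p.m, p.l, 𝟙 ((a.obj p.m).obj A), p.r⟩

/-- `twice(⟨l|r⟩) = ⟨l | l∘r | r⟩`. -/
def actTwice {S A : C} (p : ActOpticRep a S S A A) : ActOptic2 a S A :=
  Quot.mk _ ⟨p.m, p.m, p.l, p.r ≫ p.l, p.r⟩

/-- An optic `p : S ⇸ A` is lawful if `outside(p) = id_S` and `once(p) = twice(p)`
(equivalently, since `outside`, `once` and `twice` are well defined on equivalence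
classes, this holds for every representative of `p`). -/
def ActOptic.Lawful {S A : C} (p : ActOptic a S S A A) : Prop :=
  ∀ rep : ActOpticRep a S S A A, Quot.mk _ rep = p →
    rep.l ≫ rep.r = 𝟙 S ∧ actOnce a rep = actTwice a rep

variable [a.Monoidal]

/-- The identity optic `(S,S) ⇸ (S,S)`, with residual the monoidal unit of `M`,
via the unit isomorphism `Id ≅ a(I)` of the monoidal functor `a`. -/
def actIdRep (S : C) : ActOpticRep a S S S S where
  m := 𝟙_ M
  l := (ε a).app S
  r := (η a).app S

/-- Composition of representatives, `⟨l|r⟩ ∘ ⟨l'|r'⟩ = ⟨(M'·l)∘l' | r'∘(M'·r)⟩`,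
via the structure isomorphism of the monoidal functor `a`. -/
def actCompRep {R R' S S' A A' : C} (q : ActOpticRep a S S' A A')
    (p : ActOpticRep a R R' S S') : ActOpticRep a R R' A A' where
  m := q.m ⊗ p.m
  l := p.l ≫ (a.obj p.m).map q.l ≫ (μ a q.m p.m).app A
  r := (δ a q.m p.m).app A' ≫ (a.obj p.m).map q.r ≫ p.r

end Defs

section Helpers

set_option linter.unusedSectionVars false

variable (a : M ⥤ C ⥤ C)

theorem act_outside_slide {S A : C} {x y : ActOpticRep a S S A A} (h : ActOpticRel a x y) :
    x.l ≫ x.r = y.l ≫ y.r := by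
  cases h; simp

theorem act_once_slide {S A : C} {x y : ActOpticRep a S S A A} (h : ActOpticRel a x y) :
    actOnce a x = actOnce a y := by
  cases h with
  | slide f l r =>
    have h1 := Quot.sound (ActOptic2Rel.slideL f l (𝟙 _) r)
    have h2 := Quot.sound (ActOptic2Rel.slideR f l (𝟙 _) r)
    rw [Category.comp_id] at h1
    rw [Category.id_comp] at h2
    exact h1.trans h2

theorem act_twice_slide {S A : C} {x y : ActOpticRep a S S A A} (h : ActOpticRel a x y) :
    actTwice a x = actTwice a y := by
  cases h with
  | slide f l r =>
    have h1 := Quot.sound (ActOptic2Rel.slideL f l (r ≫ l ≫ (a.map f).app A) r)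
    have h2 := Quot.sound (ActOptic2Rel.slideR f l ((a.map f).app A ≫ r ≫ l) r)
    simp only [Category.assoc] at h2
    refine (h1.trans h2).trans ?_
    simp only [actTwice, Category.assoc]

theorem act_lawful_of_rep {S A : C} (p : ActOpticRep a S S A A)
    (h1 : p.l ≫ p.r = 𝟙 S) (h2 : actOnce a p = actTwice a p) :
    ActOptic.Lawful a (Quot.mk _ p) := by
  intro rep hrep
  constructor
  · rw [← h1]
    exact congrArg (Quot.lift (fun x : ActOpticRep a S S A A => x.l ≫ x.r)
      (fun _ _ h => act_outside_slide a h)) hrep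
  · have e1 : actOnce a rep = actOnce a p := congrArg (Quot.lift (actOnce a)
      (fun _ _ h => act_once_slide a h)) hrep
    have e2 : actTwice a rep = actTwice a p := congrArg (Quot.lift (actTwice a)
      (fun _ _ h => act_twice_slide a h)) hrep
    rw [e1, e2, h2]

variable [a.Monoidal]

theorem act_mu_left {m n : M} (f : m ⟶ n) (k : M) (A : C) :
    (a.obj k).map ((a.map f).app A) ≫ (μ a n k).app A =
      (μ a m k).app A ≫ (a.map (f ▷ k)).app A :=
  congrArg (fun t => t.app A) (μ_natural_left a f k)

theorem act_mu_right {m n : M} (k : M) (f : m ⟶ n) (A : C) :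
    (a.map f).app ((a.obj k).obj A) ≫ (μ a k n).app A =
      (μ a k m).app A ≫ (a.map (k ◁ f)).app A :=
  congrArg (fun t => t.app A) (μ_natural_right a k f)

theorem act_delta_left {m n : M} (f : m ⟶ n) (k : M) (A : C) :
    (δ a m k).app A ≫ (a.obj k).map ((a.map f).app A) =
      (a.map (f ▷ k)).app A ≫ (δ a n k).app A :=
  congrArg (fun t => t.app A) (δ_natural_left a f k)

theorem act_delta_right {m n : M} (k : M) (f : m ⟶ n) (A : C) :
    (δ a k m).app A ≫ (a.map f).app ((a.obj k).obj A) =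
      (a.map (k ◁ f)).app A ≫ (δ a k n).app A :=
  congrArg (fun t => t.app A) (δ_natural_right a k f)

theorem act_mu_delta (m n : M) (A : C) :
    (μ a m n).app A ≫ (δ a m n).app A = 𝟙 ((a.obj n).obj ((a.obj m).obj A)) :=
  congrArg (fun t => t.app A) (Functor.Monoidal.μ_δ a m n)

theorem act_delta_mu (m n : M) (A : C) :
    (δ a m n).app A ≫ (μ a m n).app A = 𝟙 ((a.obj (m ⊗ n)).obj A) :=
  congrArg (fun t => t.app A) (Functor.Monoidal.δ_μ a m n)

theorem act_delta_id_mu (m n : M) (A : C) :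
    (δ a m n).app A ≫ 𝟙 ((a.obj n).obj ((a.obj m).obj A)) ≫ (μ a m n).app A =
      𝟙 ((a.obj (m ⊗ n)).obj A) :=
  (congrArg (fun t => (δ a m n).app A ≫ t) (Category.id_comp ((μ a m n).app A))).trans
    (act_delta_mu a m n A)

/-- Whisker an element of the double coend on the outside by `p`. -/
def actPhiRep {R S A : C} (p : ActOpticRep a R R S S) (x : ActOptic2Rep a S A) :
    ActOptic2Rep a R A where
  m₁ := x.m₁ ⊗ p.m
  m₂ := x.m₂ ⊗ p.m
  l := p.l ≫ (a.obj p.m).map x.l ≫ (μ a x.m₁ p.m).app A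
  c := (δ a x.m₁ p.m).app A ≫ (a.obj p.m).map x.c ≫ (μ a x.m₂ p.m).app A
  r := (δ a x.m₂ p.m).app A ≫ (a.obj p.m).map x.r ≫ p.r

/-- Whisker an element of the double coend on the inside by `q`. -/
def actPsiRep {R S A : C} (q : ActOpticRep a S S A A) (x : ActOptic2Rep a R S) :
    ActOptic2Rep a R A where
  m₁ := q.m ⊗ x.m₁
  m₂ := q.m ⊗ x.m₂
  l := x.l ≫ (a.obj x.m₁).map q.l ≫ (μ a q.m x.m₁).app A
  c := (δ a q.m x.m₁).app A ≫ (a.obj x.m₁).map q.r ≫ x.c ≫ (a.obj x.m₂).map q.l ≫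
    (μ a q.m x.m₂).app A
  r := (δ a q.m x.m₂).app A ≫ (a.obj x.m₂).map q.r ≫ x.r

theorem act2_slideL {S A : C} {m₁ n₁ m₂ : M} (f : m₁ ⟶ n₁) (l : S ⟶ (a.obj m₁).obj A)
    (c : (a.obj n₁).obj A ⟶ (a.obj m₂).obj A) (r : (a.obj m₂).obj A ⟶ S)
    (l' : S ⟶ (a.obj n₁).obj A) (c' : (a.obj m₁).obj A ⟶ (a.obj m₂).obj A)
    (hl : l' = l ≫ (a.map f).app A) (hc : c' = (a.map f).app A ≫ c) :
    Quot.mk (ActOptic2Rel a) ⟨n₁, m₂, l', c, r⟩ = Quot.mk (ActOptic2Rel a) ⟨m₁, m₂, l, c', r⟩ := by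
  subst hl hc
  exact Quot.sound (ActOptic2Rel.slideL f l c r)

theorem act2_slideR {S A : C} {m₁ m₂ n₂ : M} (g : m₂ ⟶ n₂) (l : S ⟶ (a.obj m₁).obj A)
    (c : (a.obj m₁).obj A ⟶ (a.obj m₂).obj A) (r : (a.obj n₂).obj A ⟶ S)
    (c' : (a.obj m₁).obj A ⟶ (a.obj n₂).obj A) (r' : (a.obj m₂).obj A ⟶ S)
    (hc : c' = c ≫ (a.map g).app A) (hr : r' = (a.map g).app A ≫ r) :
    Quot.mk (ActOptic2Rel a) ⟨m₁, n₂, l, c', r⟩ = Quot.mk (ActOptic2Rel a) ⟨m₁, m₂, l, c, r'⟩ := by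
  subst hc hr
  exact Quot.sound (ActOptic2Rel.slideR g l c r)

theorem actPhi_slide {R S A : C} (p : ActOpticRep a R R S S) {x y : ActOptic2Rep a S A}
    (h : ActOptic2Rel a x y) :
    Quot.mk (ActOptic2Rel a) (actPhiRep a p x) = Quot.mk (ActOptic2Rel a) (actPhiRep a p y) := by
  cases h with
  | slideL f l c r =>
    refine act2_slideL a (f ▷ p.m) _ _ _ _ _ ?_ ?_
    · simp only [Functor.map_comp, Category.assoc, act_mu_left]
    · simp only [Functor.map_comp, Category.assoc]
      simp only [← Category.assoc, act_delta_left]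
  | slideR g l c r =>
    refine act2_slideR a (g ▷ p.m) _ _ _ _ _ ?_ ?_
    · simp only [Functor.map_comp, Category.assoc, act_mu_left]
    · simp only [Functor.map_comp, Category.assoc]
      simp only [← Category.assoc, act_delta_left]

theorem actPsi_slide {R S A : C} (q : ActOpticRep a S S A A) {x y : ActOptic2Rep a R S}
    (h : ActOptic2Rel a x y) :
    Quot.mk (ActOptic2Rel a) (actPsiRep a q x) = Quot.mk (ActOptic2Rel a) (actPsiRep a q y) := by
  cases h with
  | slideL f l c r =>
    refine act2_slideL a (q.m ◁ f) _ _ _ _ _ ?_ ?_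
    · simp only [Category.assoc, ← act_mu_right, NatTrans.naturality_assoc]
    · simp only [← Category.assoc, ← act_delta_right]
      simp only [Category.assoc, NatTrans.naturality_assoc]
  | slideR g l c r =>
    refine act2_slideR a (q.m ◁ g) _ _ _ _ _ ?_ ?_
    · simp only [Category.assoc, ← act_mu_right, NatTrans.naturality_assoc]
    · simp only [← Category.assoc, ← act_delta_right]
      simp only [Category.assoc, NatTrans.naturality_assoc]

theorem act_comp_once {R S A : C} (q : ActOpticRep a S S A A) (p : ActOpticRep a R R S S)
    (hq : actOnce a q = actTwice a q) (hp : actOnce a p = actTwice a p) :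
    actOnce a (actCompRep a q p) = actTwice a (actCompRep a q p) := by
  have h1 := congrArg (Quot.lift (fun x => Quot.mk (ActOptic2Rel a) (actPhiRep a p x))
    (fun _ _ h => actPhi_slide a p h)) hq
  have h2 := congrArg (Quot.lift (fun x => Quot.mk (ActOptic2Rel a) (actPsiRep a q x))
    (fun _ _ h => actPsi_slide a q h)) hp
  simp only [actOnce, actTwice, actPhiRep, actPsiRep, CategoryTheory.Functor.map_id, Functor.map_comp,
    Category.id_comp, Category.assoc, act_delta_id_mu] at h1 h2
  refine h1.trans (h2.trans ?_)
  simp only [actTwice, actCompRep, Category.assoc]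

end Helpers

/-- **Statement 13.** The objects `(S,S)` and the lawful optics form a subcategory of
`Optic_M`: all identity optics are lawful, and the composite of lawful optics is lawful. -/
theorem lawful_is_subcategory (a : M ⥤ C ⥤ C) [a.Monoidal] :
    (∀ S : C, ActOptic.Lawful a (Quot.mk _ (actIdRep a S))) ∧
    (∀ (R S A : C) (q : ActOpticRep a S S A A) (p : ActOpticRep a R R S S),
        ActOptic.Lawful a (Quot.mk _ q) → ActOptic.Lawful a (Quot.mk _ p) →
        ActOptic.Lawful a (Quot.mk _ (actCompRep a q p))) := by
  refine ⟨fun S => ?_, fun R S A q p hq hp => ?_⟩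
  · have e1 : (ε a).app S ≫ (η a).app S = 𝟙 S :=
      congrArg (fun t => t.app S) (Functor.Monoidal.ε_η a)
    have e2 : (η a).app S ≫ (ε a).app S = 𝟙 ((a.obj (𝟙_ M)).obj S) :=
      congrArg (fun t => t.app S) (Functor.Monoidal.η_ε a)
    refine act_lawful_of_rep a _ e1 ?_
    exact congrArg (fun c => Quot.mk (ActOptic2Rel a)
      (⟨𝟙_ M, 𝟙_ M, (ε a).app S, c, (η a).app S⟩ : ActOptic2Rep a S S)) e2.symm
  · obtain ⟨q1, q2⟩ := hq q rfl
    obtain ⟨p1, p2⟩ := hp p rfl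
    refine act_lawful_of_rep a _ ?_ (act_comp_once a q p q2 p2)
    have e := act_mu_delta a q.m p.m A
    calc (p.l ≫ (a.obj p.m).map q.l ≫ (μ a q.m p.m).app A) ≫
          ((δ a q.m p.m).app A ≫ (a.obj p.m).map q.r ≫ p.r)
        = p.l ≫ (a.obj p.m).map q.l ≫ ((μ a q.m p.m).app A ≫
          (δ a q.m p.m).app A) ≫ (a.obj p.m).map q.r ≫ p.r := by
          simp only [Category.assoc]
      _ = p.l ≫ (a.obj p.m).map (q.l ≫ q.r) ≫ p.r := by
          rw [e, Functor.map_comp, Category.assoc]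
          exact congrArg (fun t => p.l ≫ (a.obj p.m).map q.l ≫ t) (Category.id_comp _)
      _ = 𝟙 R := by rw [q1, CategoryTheory.Functor.map_id, Category.id_comp, p1]
end

section
/- Suppose an optic p : S ⇸ A satisfies outside(p) = id_S and inside(p) = ⟨φ·A⟩ for some φ : M → M in M, where inside : Optic_M(S,A) → ∫^{M∈M} C(M·A, M·A) is induced by ⟨l|r⟩ ↦ ⟨l∘r⟩. Then there exists a representative ⟨l|r⟩ of p and an endomorphism ψ : M' → M' in M such that l∘r = ψ·A on the nose. -/
/-!
STATEMENT 14: Suppose an optic `p : S ⇸ A` satisfies `outside(p) = id_S` and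
`inside(p) = ⟨φ·A⟩` for some `φ : M → M` in `M`, where
`inside : Optic_M(S,A) → ∫^{M∈M} C(M·A, M·A)` is induced by `⟨l|r⟩ ↦ ⟨l∘r⟩`. Then there
exists a representative `⟨l|r⟩` of `p` and an endomorphism `ψ : M' → M'` in `M` such that
`l∘r = ψ·A` on the nose.
-/

open CategoryTheory MonoidalCategory Functor.LaxMonoidal Functor.OplaxMonoidal

universe v u v' u'

attribute [local instance] CategoryTheory.endofunctorMonoidalCategory

variable {M : Type u'} [Category.{v'} M] [MonoidalCategory M]
variable {C : Type u} [Category.{v} C]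

/-- A representative of an element of `∫^{m∈M} C(m·A, m·A)`. -/
structure EndoRep (a : M ⥤ C ⥤ C) (A : C) : Type max u v u' where
  m : M
  f : (a.obj m).obj A ⟶ (a.obj m).obj A

variable (a : M ⥤ C ⥤ C)

/-- The coend relation `⟨(φ·A)∘f⟩ ∼ ⟨f∘(φ·A)⟩`, for `f : n·A ⟶ m·A` and `φ : m ⟶ n`. -/
inductive EndoRel {A : C} : EndoRep a A → EndoRep a A → Prop
  | slide {m n : M} (φ : m ⟶ n) (f : (a.obj n).obj A ⟶ (a.obj m).obj A) :
      EndoRel ⟨n, f ≫ (a.map φ).app A⟩ ⟨m, (a.map φ).app A ≫ f⟩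

/-- The coend `∫^{m∈M} C(m·A, m·A)`. -/
def EndoCoend (A : C) : Type max u v u' :=
  Quot (EndoRel a (A := A))

/-- Iterated composition of an endomorphism. -/
def endoPow {D : Type u} [Category.{v} D] {X : D} (f : X ⟶ X) : ℕ → (X ⟶ X)
  | 0 => 𝟙 X
  | k + 1 => f ≫ endoPow f k

theorem endoPow_slide {D : Type u} [Category.{v} D] {X Y : D} (h : X ⟶ Y) (g : Y ⟶ X) (k : ℕ) :
    endoPow (h ≫ g) k ≫ h = h ≫ endoPow (g ≫ h) k := by
  induction k with
  | zero => simp [endoPow]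
  | succ k ih => simp [endoPow, ih]

theorem map_endoPow {A : C} {m : M} (φ : m ⟶ m) (k : ℕ) :
    endoPow ((a.map φ).app A) k = (a.map (endoPow φ k)).app A := by
  induction k with
  | zero => simp [endoPow]
  | succ k ih => simp [endoPow, ih]

/-- The invariant carried along the chain of slides. -/
def Good {S A : C} (p : ActOptic a S S A A) (x : EndoRep a A) : Prop :=
  ∃ (l : S ⟶ (a.obj x.m).obj A) (r : (a.obj x.m).obj A ⟶ S) (k : ℕ),
    l ≫ x.f = l ∧ x.f ≫ r = r ∧ Quot.mk _ ⟨x.m, l, r⟩ = p ∧ r ≫ l = endoPow x.f k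

theorem good_step {S A : C} (p : ActOptic a S S A A) {m n : M}
    (h : (a.obj m).obj A ⟶ (a.obj n).obj A) (g : (a.obj n).obj A ⟶ (a.obj m).obj A)
    (hq : ∀ (l : S ⟶ (a.obj m).obj A) (r : (a.obj m).obj A ⟶ S),
      l ≫ h ≫ g = l → (h ≫ g) ≫ r = r →
      (Quot.mk _ ⟨n, l ≫ h, g ≫ r⟩ : ActOptic a S S A A) = Quot.mk _ ⟨m, l, r⟩)
    (H : Good a p ⟨m, h ≫ g⟩) : Good a p ⟨n, g ≫ h⟩ := by
  obtain ⟨l, r, k, h1, h2, h3, h4⟩ := H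
  dsimp only at l r h1 h2 h3 h4
  refine ⟨l ≫ h, g ≫ r, k + 1, ?_, ?_, (hq l r h1 h2).trans h3, ?_⟩
  · have := congrArg (· ≫ h) h1
    simpa using this
  · have := congrArg (g ≫ ·) h2
    simpa using this
  · have h5 : (g ≫ r) ≫ l ≫ h = g ≫ (r ≫ l) ≫ h := by simp
    dsimp only
    rw [h5, h4, endoPow_slide]
    simp [endoPow]

theorem good_iff {S A : C} (p : ActOptic a S S A A) (x y : EndoRep a A) (hxy : EndoRel a x y) :
    Good a p x = Good a p y := by
  obtain ⟨χ, f⟩ := hxy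
  refine propext ⟨good_step a p _ _ ?_, good_step a p _ _ ?_⟩
  · intro l r h1 h2
    have := Quot.sound (ActOpticRel.slide (a := a) χ (l ≫ f) r)
    rw [Category.assoc, h1] at this
    exact this.symm
  · intro l r h1 h2
    have := Quot.sound (ActOpticRel.slide (a := a) χ l (f ≫ r))
    rw [← Category.assoc ((a.map χ).app A), h2] at this
    exact this

/-- **Statement 14.** If `p : S ⇸ A` satisfies `outside(p) = id_S` (i.e. `l ≫ r = 𝟙 S` for
the representatives of `p`) and `inside(p) = ⟨φ·A⟩` in `∫^m C(m·A, m·A)` for some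
endomorphism `φ : m₀ ⟶ m₀` of `M`, then `p` has a representative `⟨l|r⟩` such that
`l∘r = ψ·A` on the nose for some endomorphism `ψ` of its residual. -/
theorem exists_rep_inside_on_the_nose [a.Monoidal] {S A : C} (p : ActOptic a S S A A)
    (m₀ : M) (φ : m₀ ⟶ m₀)
    (houtside : ∀ rep : ActOpticRep a S S A A, Quot.mk _ rep = p → rep.l ≫ rep.r = 𝟙 S)
    (hinside : ∀ rep : ActOpticRep a S S A A, Quot.mk _ rep = p →
        (Quot.mk _ ⟨rep.m, rep.r ≫ rep.l⟩ : EndoCoend a A) =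
          Quot.mk _ ⟨m₀, (a.map φ).app A⟩) :
    ∃ (rep : ActOpticRep a S S A A) (ψ : rep.m ⟶ rep.m),
      Quot.mk _ rep = p ∧ rep.r ≫ rep.l = (a.map ψ).app A := by
  obtain ⟨⟨m, l, r⟩, rfl⟩ := Quot.exists_rep p
  have ho := houtside _ rfl
  have hi := hinside _ rfl
  dsimp only at ho hi
  have h0 : Good a (Quot.mk _ ⟨m, l, r⟩) ⟨m, r ≫ l⟩ := by
    refine ⟨l, r, 1, ?_, ?_, rfl, ?_⟩
    · dsimp only
      rw [← Category.assoc, ho, Category.id_comp]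
    · dsimp only
      rw [Category.assoc, ho, Category.comp_id]
    · simp [endoPow]
  have h1 : Good a (Quot.mk _ ⟨m, l, r⟩) ⟨m₀, (a.map φ).app A⟩ :=
    (congrArg (Quot.lift (Good a (Quot.mk _ ⟨m, l, r⟩)) (good_iff a _)) hi).mp h0
  obtain ⟨l', r', k, -, -, h3, h4⟩ := h1
  exact ⟨⟨m₀, l', r'⟩, endoPow φ k, h3, h4.trans (map_endoPow a φ k)⟩
end

section
/- Suppose for a fixed object A the evaluation-at-A functor −·A : M → C has a right adjoint R_A : C → M, with unit η and counit ε. Then optics S ⇸ A correspond bijectively to morphisms Unzip : S → (R_A S)·A (with Unzip corresponding to ⟨Unzip | ε_S⟩), and the optic ⟨Unzip | ε_S⟩ is lawful if and only if Unzip is a coalgebra for the comonad X ↦ (R_A X)·A; that is, if and only if ε_S ∘ Unzip = id_S and (η_{R_A S}·A) ∘ Unzip = (R_A(Unzip)·A) ∘ Unzip. -/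
/-!
STATEMENT 15: Suppose for a fixed object `A` the evaluation-at-`A` functor `−·A : M → C`
has a right adjoint `R_A : C → M`, with unit `η` and counit `ε`. Then optics `S ⇸ A`
correspond bijectively to morphisms `Unzip : S → (R_A S)·A` (with `Unzip` corresponding to
`⟨Unzip | ε_S⟩`), and the optic `⟨Unzip | ε_S⟩` is lawful if and only if `Unzip` is a
coalgebra for the comonad `X ↦ (R_A X)·A`; that is, iff `ε_S ∘ Unzip = id_S` and
`(η_{R_A S}·A) ∘ Unzip = (R_A(Unzip)·A) ∘ Unzip`.
-/

open CategoryTheory MonoidalCategory Functor.LaxMonoidal Functor.OplaxMonoidal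

universe v u v' u'

attribute [local instance] CategoryTheory.endofunctorMonoidalCategory

variable {M : Type u'} [Category.{v'} M] [MonoidalCategory M]
variable {C : Type u} [Category.{v} C]

variable (a : M ⥤ C ⥤ C)

theorem actOnce_rel {S A : C} {p q : ActOpticRep a S S A A} (h : ActOpticRel a p q) :
    actOnce a p = actOnce a q := by
  cases h with
  | slide f l r =>
    refine (Quot.sound (ActOptic2Rel.slideL f l (𝟙 _) r)).trans ?_
    refine Eq.trans ?_ (Quot.sound (ActOptic2Rel.slideR f l (𝟙 _) r))
    simp

theorem actTwice_rel {S A : C} {p q : ActOpticRep a S S A A} (h : ActOpticRel a p q) :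
    actTwice a p = actTwice a q := by
  cases h with
  | slide f l r =>
    refine (Quot.sound (ActOptic2Rel.slideL f l (r ≫ l ≫ (a.map f).app A) r)).trans ?_
    refine Eq.trans ?_ (Quot.sound (ActOptic2Rel.slideR f l (((a.map f).app A ≫ r) ≫ l) r))
    simp

theorem actOutside_rel {S A : C} {p q : ActOpticRep a S S A A} (h : ActOpticRel a p q) :
    p.l ≫ p.r = q.l ≫ q.r := by
  cases h with
  | slide f l r => simp

/-- Normal form of an optic. -/
def actNorm (A : C) (R : C ⥤ M)
    (adj : (a ⋙ (CategoryTheory.evaluation C C).obj A) ⊣ R) (S : C) :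
    ActOptic a S S A A → (S ⟶ (a.obj (R.obj S)).obj A) :=
  Quot.lift (fun p => p.l ≫ (a.map (adj.homEquiv _ _ p.r)).app A) (by
    rintro _ _ ⟨f, l, r⟩
    have := adj.homEquiv_naturality_left f r
    dsimp at this ⊢
    rw [this]
    simp)

/-- Normal form of an element of `Optic²`. -/
def actNorm2 (A : C) (R : C ⥤ M)
    (adj : (a ⋙ (CategoryTheory.evaluation C C).obj A) ⊣ R) (S : C) :
    ActOptic2 a S A → (S ⟶ (a.obj (R.obj ((a.obj (R.obj S)).obj A))).obj A) :=
  Quot.lift (fun p => p.l ≫ (a.map (adj.homEquiv p.m₁ ((a.obj (R.obj S)).obj A)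
      (p.c ≫ (a.map (adj.homEquiv p.m₂ S p.r)).app A))).app A) (by
    rintro _ _ (⟨f, l, c, r⟩ | ⟨g, l, c, r⟩)
    · have := adj.homEquiv_naturality_left f (c ≫ (a.map (adj.homEquiv _ S r)).app A)
      dsimp at this ⊢
      rw [Category.assoc, Category.assoc, this]
      simp
    · have := adj.homEquiv_naturality_left g r
      dsimp at this ⊢
      rw [this]
      simp)

/-- **Statement 15.** If evaluation at `A` has a right adjoint `R_A`, then
`Unzip ↦ ⟨Unzip | ε_S⟩` is a bijection between morphisms `S ⟶ (R_A S)·A` and optics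
`S ⇸ A`, and `⟨Unzip | ε_S⟩` is lawful iff `Unzip` is a coalgebra for the comonad
`X ↦ (R_A X)·A`, i.e. iff `ε_S ∘ Unzip = id_S` and
`(η_{R_A S}·A) ∘ Unzip = (R_A(Unzip)·A) ∘ Unzip`. -/
theorem coalgebraic_optics [a.Monoidal] (A : C) (R : C ⥤ M)
    (adj : (a ⋙ (CategoryTheory.evaluation C C).obj A) ⊣ R) (S : C) :
    Function.Bijective
      (fun u : S ⟶ (a.obj (R.obj S)).obj A =>
        (Quot.mk _ ⟨R.obj S, u, adj.counit.app S⟩ : ActOptic a S S A A)) ∧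
    ∀ u : S ⟶ (a.obj (R.obj S)).obj A,
      ActOptic.Lawful a (Quot.mk _ ⟨R.obj S, u, adj.counit.app S⟩) ↔
        (u ≫ adj.counit.app S = 𝟙 S ∧
         u ≫ (a.map (adj.unit.app (R.obj S))).app A = u ≫ (a.map (R.map u)).app A) := by
  have hε : adj.homEquiv (R.obj S) S (adj.counit.app S) = 𝟙 _ := by
    simp [Adjunction.homEquiv_unit]
  refine ⟨⟨?_, ?_⟩, ?_⟩
  · intro u v h
    have h' := congrArg (actNorm a A R adj S) h
    change u ≫ (a.map (adj.homEquiv (R.obj S) S (adj.counit.app S))).app A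
      = v ≫ (a.map (adj.homEquiv (R.obj S) S (adj.counit.app S))).app A at h'
    rw [hε] at h'
    simpa using h'
  · rintro ⟨m, l, r⟩
    refine ⟨l ≫ (a.map (adj.homEquiv _ _ r)).app A, ?_⟩
    refine (Quot.sound (ActOpticRel.slide (adj.homEquiv _ _ r) l (adj.counit.app S))).trans ?_
    have h : (a.map (adj.homEquiv m S r)).app A ≫ adj.counit.app S = r := by
      have := adj.homEquiv_counit (g := adj.homEquiv m S r)
      rw [Equiv.symm_apply_apply] at this
      exact this.symm
    rw [h]
  · intro u
    have key : ActOptic.Lawful a (Quot.mk _ ⟨R.obj S, u, adj.counit.app S⟩) ↔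
        (u ≫ adj.counit.app S = 𝟙 S ∧
          actOnce a ⟨R.obj S, u, adj.counit.app S⟩
            = actTwice a ⟨R.obj S, u, adj.counit.app S⟩) := by
      constructor
      · intro h
        exact h _ rfl
      · rintro ⟨h1, h2⟩ rep hrep
        have e0 : rep.l ≫ rep.r = u ≫ adj.counit.app S :=
          congrArg (Quot.lift (fun p : ActOpticRep a S S A A => p.l ≫ p.r)
            (fun _ _ h => actOutside_rel a h)) hrep
        have e1 : actOnce a rep = actOnce a ⟨R.obj S, u, adj.counit.app S⟩ :=
          congrArg (Quot.lift (actOnce a) (fun _ _ h => actOnce_rel a h)) hrep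
        have e2 : actTwice a rep = actTwice a ⟨R.obj S, u, adj.counit.app S⟩ :=
          congrArg (Quot.lift (actTwice a) (fun _ _ h => actTwice_rel a h)) hrep
        exact ⟨e0.trans h1, e1.trans (h2.trans e2.symm)⟩
    rw [key]
    refine and_congr_right fun _ => ⟨fun h => ?_, fun h => ?_⟩
    · have h' := congrArg (actNorm2 a A R adj S) h
      change u ≫ (a.map (adj.homEquiv (R.obj S) ((a.obj (R.obj S)).obj A)
          (𝟙 ((a.obj (R.obj S)).obj A) ≫ (a.map (adj.homEquiv (R.obj S) S (adj.counit.app S))).app A))).app A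
        = u ≫ (a.map (adj.homEquiv (R.obj S) ((a.obj (R.obj S)).obj A)
          ((adj.counit.app S ≫ u) ≫
            (a.map (adj.homEquiv (R.obj S) S (adj.counit.app S))).app A))).app A at h'
      have h1 : adj.homEquiv (R.obj S) ((a.obj (R.obj S)).obj A) (𝟙 ((a.obj (R.obj S)).obj A))
          = adj.unit.app (R.obj S) := adj.homEquiv_id _
      have h2 : adj.homEquiv (R.obj S) ((a.obj (R.obj S)).obj A) (adj.counit.app S ≫ u)
          = R.map u := by
        rw [adj.homEquiv_naturality_right]
        exact (congrArg (· ≫ R.map u) hε).trans (Category.id_comp _)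
      have h3 : (a.map (𝟙 (R.obj S))).app A = 𝟙 _ := by simp
      rw [hε, h3, Category.comp_id, Category.comp_id, h1, h2] at h'
      exact h'
    · have t : (a.map (adj.unit.app (R.obj S))).app A
          ≫ adj.counit.app ((a.obj (R.obj S)).obj A) = 𝟙 _ :=
        adj.left_triangle_components (R.obj S)
      have n : (a.map (R.map u)).app A ≫ adj.counit.app ((a.obj (R.obj S)).obj A)
          = adj.counit.app S ≫ u := adj.counit.naturality u
      have q1 := Quot.sound (ActOptic2Rel.slideL (adj.unit.app (R.obj S)) u
        (adj.counit.app ((a.obj (R.obj S)).obj A)) (adj.counit.app S))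
      have q2 := Quot.sound (ActOptic2Rel.slideL (R.map u) u
        (adj.counit.app ((a.obj (R.obj S)).obj A)) (adj.counit.app S))
      erw [t] at q1
      erw [n] at q2
      refine q1.symm.trans (Eq.trans ?_ q2)
      exact congrArg (fun x => Quot.mk _ (⟨_, _, x, _, _⟩ : ActOptic2Rep a S A)) h
end
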